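/- Among all polynomials of the form P(x) = x^{2m} + Q(x) with deg Q < 2m that are nondecreasing on [-1,1], the minimal possible sup-norm on [-1,1] is 2·(m!/(2m−1)!!)^2; i.e., inf{ ‖P‖_{C[-1,1]} : P(x) = x^{2m} + lower order terms, P nondecreasing on [-1,1] } = 2 (m!/(2m−1)!!)^2. -/

import Mathlib

open Set Finset

/-- Sup norm on `[-1,1]`. -/
noncomputable def supNorm (f : ℝ → ℝ) : ℝ :=
  sSup ((fun x => |f x|) '' Icc (-1:ℝ) 1)

section

open Polynomial

/-- Integration over `[-1, 1]` as a linear functional on real polynomials. -/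
noncomputable def integralLM : ℝ[X] →ₗ[ℝ] ℝ where
  toFun p := ∫ x in (-1 : ℝ)..1, p.eval x
  map_add' p q := by
    simp only [eval_add]
    exact intervalIntegral.integral_add (p.continuous.intervalIntegrable _ _)
      (q.continuous.intervalIntegrable _ _)
  map_smul' c p := by simp

lemma integralLM_apply (p : ℝ[X]) : integralLM p = ∫ x in (-1 : ℝ)..1, p.eval x := rfl

lemma integralLM_nonneg {p : ℝ[X]} (hp : ∀ x ∈ Set.Icc (-1 : ℝ) 1, 0 ≤ p.eval x) :
    0 ≤ integralLM p :=
  intervalIntegral.integral_nonneg (by norm_num) hp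

lemma integralLM_derivative (p : ℝ[X]) :
    integralLM (derivative p) = p.eval 1 - p.eval (-1) :=
  intervalIntegral.integral_eq_sub_of_hasDerivAt (fun x _ => p.hasDerivAt x)
    (p.derivative.continuous.intervalIntegrable _ _)

lemma integralLM_mul_derivative (p q : ℝ[X]) :
    integralLM (p * derivative q) =
      p.eval 1 * q.eval 1 - p.eval (-1) * q.eval (-1) - integralLM (derivative p * q) := by
  have h := integralLM_derivative (p * q)
  rw [derivative_mul, map_add, eval_mul, eval_mul] at h
  linarith

lemma integralLM_mul_iterate_derivative {g : ℝ[X]} {k : ℕ}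
    (h1 : ∀ j < k, (derivative^[j] g).eval 1 = 0)
    (h2 : ∀ j < k, (derivative^[j] g).eval (-1) = 0) (f : ℝ[X]) :
    integralLM (f * derivative^[k] g) = (-1) ^ k * integralLM (derivative^[k] f * g) := by
  induction k generalizing f with
  | zero => simp
  | succ k ih =>
    rw [Function.iterate_succ_apply', integralLM_mul_derivative, h1 k k.lt_succ_self,
      h2 k k.lt_succ_self, ih (fun j hj => h1 j (hj.trans k.lt_succ_self))
      (fun j hj => h2 j (hj.trans k.lt_succ_self)), Function.iterate_succ_apply]
    ring

lemma integralLM_add_one_pow_mul_sub_one_pow (a b : ℕ) :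
    integralLM ((X + 1) ^ a * (X - 1) ^ b) =
      (-1) ^ b * (a.factorial * b.factorial * 2 ^ (a + b + 1) / (a + b + 1).factorial) := by
  induction b generalizing a with
  | zero =>
    have h := integralLM_derivative ((X + 1) ^ (a + 1))
    have hd : derivative ((X + 1 : ℝ[X]) ^ (a + 1)) = ((a : ℝ) + 1) • (X + 1) ^ a := by
      simp [derivative_pow, smul_eq_C_mul]
    rw [hd, map_smul, smul_eq_mul] at h
    simp only [eval_pow, eval_add, eval_X, eval_one, neg_add_cancel, ne_eq, Nat.succ_ne_zero,
      not_false_eq_true, zero_pow, sub_zero] at h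
    have ha : (a : ℝ) + 1 ≠ 0 := by positivity
    have hf : (a.factorial : ℝ) ≠ 0 := by positivity
    simp only [pow_zero, mul_one, Nat.factorial_zero, Nat.cast_one, add_zero, one_mul,
      Nat.factorial_succ, Nat.cast_mul, Nat.cast_add]
    field_simp
    rw [mul_comm, h]
    norm_num
  | succ b ih =>
    have h := integralLM_mul_derivative ((X - 1) ^ (b + 1)) ((X + 1) ^ (a + 1))
    have h1 : (X - 1 : ℝ[X]) ^ (b + 1) * derivative ((X + 1 : ℝ[X]) ^ (a + 1)) =
        ((a : ℝ) + 1) • ((X + 1) ^ a * (X - 1) ^ (b + 1)) := by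
      simp [derivative_pow, smul_eq_C_mul]; ring
    have h2 : derivative ((X - 1 : ℝ[X]) ^ (b + 1)) * (X + 1 : ℝ[X]) ^ (a + 1) =
        ((b : ℝ) + 1) • ((X + 1) ^ (a + 1) * (X - 1) ^ b) := by
      simp [derivative_pow, smul_eq_C_mul]; ring
    rw [h1, h2, map_smul, map_smul, smul_eq_mul, smul_eq_mul, ih] at h
    simp only [eval_pow, eval_add, eval_sub, eval_X, eval_one, neg_add_cancel, ne_eq,
      Nat.succ_ne_zero, not_false_eq_true, zero_pow, sub_self, zero_mul, mul_zero, zero_sub] at h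
    have ha : (a : ℝ) + 1 ≠ 0 := by positivity
    apply mul_left_cancel₀ ha
    rw [h, show a + 1 + b + 1 = a + (b + 1) + 1 by ring]
    simp only [Nat.factorial_succ a, Nat.factorial_succ b]
    push_cast
    ring

/-- If `p` vanishes at `±1` and at `n` points of `(-1, 1)`, its derivative has
`n + 1` roots there. -/
lemma card_le_card_roots_derivative_Ioo {p : ℝ[X]} (hp : derivative p ≠ 0) (s : Finset ℝ)
    (hs : ∀ x ∈ s, x ∈ Set.Ioo (-1 : ℝ) 1 ∧ p.eval x = 0) (h1 : p.eval 1 = 0)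
    (h2 : p.eval (-1) = 0) :
    ∃ t : Finset ℝ, (∀ x ∈ t, x ∈ Set.Ioo (-1 : ℝ) 1 ∧ (derivative p).eval x = 0) ∧
      t.card = s.card + 1 := by
  classical
  let t := (derivative p).roots.toFinset.filter (· ∈ Set.Ioo (-1 : ℝ) 1)
  let s' := insert (-1) (insert 1 s)
  have hs' : ∀ x ∈ s', x ∈ Set.Icc (-1 : ℝ) 1 ∧ p.eval x = 0 := by
    intro x hx
    rcases Finset.mem_insert.1 hx with rfl | hx
    · exact ⟨by norm_num, h2⟩
    rcases Finset.mem_insert.1 hx with rfl | hx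
    · exact ⟨by norm_num, h1⟩
    · exact ⟨Set.Ioo_subset_Icc_self (hs x hx).1, (hs x hx).2⟩
  have hcard : s'.card = s.card + 2 := by
    rw [Finset.card_insert_of_notMem, Finset.card_insert_of_notMem]
    · exact fun h => lt_irrefl _ (hs 1 h).1.2
    · intro h
      rcases Finset.mem_insert.1 h with h | h
      · norm_num at h
      · exact lt_irrefl _ (hs _ h).1.1
  have hle : s'.card ≤ t.card + 1 := by
    refine Finset.card_le_of_interleaved fun x hx y hy hxy _ => ?_
    obtain ⟨z, hz, hz'⟩ := exists_deriv_eq_zero hxy p.continuousOn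
      ((hs' x hx).2.trans (hs' y hy).2.symm)
    refine ⟨z, Finset.mem_filter.2 ⟨?_, (hs' x hx).1.1.trans_lt hz.1,
      hz.2.trans_le (hs' y hy).1.2⟩, hz⟩
    rwa [Multiset.mem_toFinset, mem_roots hp, IsRoot, ← p.deriv]
  obtain ⟨u, hut, hu⟩ := Finset.exists_subset_card_eq (show s.card + 1 ≤ t.card by lia)
  refine ⟨u, fun x hx => ?_, hu⟩
  have := Finset.mem_filter.1 (hut hx)
  exact ⟨this.2, isRoot_of_mem_roots (Multiset.mem_toFinset.1 this.1)⟩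

/-- The polynomial whose `k`-th derivative is, by Rodrigues' formula, a multiple of
`1 + x` times the Jacobi polynomial orthogonal for the weight `1 + x`. -/
noncomputable def rodrigues (k : ℕ) : ℝ[X] := (X + 1) ^ (k + 1) * (X - 1) ^ k

lemma rodrigues_monic (k : ℕ) : (rodrigues k).Monic :=
  ((monic_X_add_C (1 : ℝ)).pow _).mul ((monic_X_sub_C (1 : ℝ)).pow _)

lemma natDegree_rodrigues (k : ℕ) : (rodrigues k).natDegree = 2 * k + 1 := by
  have h1 : (X + 1 : ℝ[X]).Monic := monic_X_add_C (1 : ℝ)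
  have h2 : (X - 1 : ℝ[X]).Monic := monic_X_sub_C (1 : ℝ)
  have h3 : (X + 1 : ℝ[X]).natDegree = 1 := natDegree_X_add_C (1 : ℝ)
  have h4 : (X - 1 : ℝ[X]).natDegree = 1 := natDegree_X_sub_C (1 : ℝ)
  rw [rodrigues, (h1.pow _).natDegree_mul (h2.pow _), h1.natDegree_pow, h2.natDegree_pow, h3, h4]
  ring

lemma natDegree_iterate_derivative_eq (p : ℝ[X]) (k : ℕ) :
    (derivative^[k] p).natDegree = p.natDegree - k := by
  induction k with
  | zero => simp
  | succ k ih => rw [Function.iterate_succ_apply', natDegree_derivative, ih]; lia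

lemma iterate_derivative_rodrigues_ne_zero {k j : ℕ} (hj : j ≤ k) :
    derivative^[j] (rodrigues k) ≠ 0 := by
  intro h
  have := natDegree_iterate_derivative_eq (rodrigues k) j
  rw [h, natDegree_zero, natDegree_rodrigues] at this
  lia

lemma eval_one_iterate_derivative_rodrigues {k j : ℕ} (hj : j < k) :
    (derivative^[j] (rodrigues k)).eval 1 = 0 := by
  have h := pow_sub_dvd_iterate_derivative_of_pow_dvd j
    (show (X - 1 : ℝ[X]) ^ k ∣ rodrigues k from Dvd.intro_left _ rfl)
  refine eval_eq_zero_of_dvd_of_eval_eq_zero h ?_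
  simp [(Nat.sub_pos_of_lt hj).ne']

lemma eval_neg_one_iterate_derivative_rodrigues {k j : ℕ} (hj : j ≤ k) :
    (derivative^[j] (rodrigues k)).eval (-1) = 0 := by
  have h := pow_sub_dvd_iterate_derivative_of_pow_dvd j
    (show (X + 1 : ℝ[X]) ^ (k + 1) ∣ rodrigues k from Dvd.intro _ rfl)
  refine eval_eq_zero_of_dvd_of_eval_eq_zero h ?_
  simp [show k + 1 - j ≠ 0 by lia]

lemma exists_roots_iterate_derivative_rodrigues (k : ℕ) {j : ℕ} (hj : j ≤ k) :
    ∃ t : Finset ℝ,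
      (∀ x ∈ t, x ∈ Set.Ioo (-1 : ℝ) 1 ∧ (derivative^[j] (rodrigues k)).eval x = 0) ∧
      t.card = j := by
  induction j with
  | zero => exact ⟨∅, by simp, rfl⟩
  | succ j ih =>
    obtain ⟨s, hs, hcard⟩ := ih (by lia)
    have hne := iterate_derivative_rodrigues_ne_zero hj
    rw [Function.iterate_succ_apply'] at hne ⊢
    obtain ⟨t, ht, htcard⟩ := card_le_card_roots_derivative_Ioo hne s hs
      (eval_one_iterate_derivative_rodrigues (by lia))
      (eval_neg_one_iterate_derivative_rodrigues (by lia))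
    exact ⟨t, ht, htcard.trans (by rw [hcard])⟩

/-- The nodes of Gauss-Radau quadrature: `rodrigues` differentiated `k` times splits with simple
roots, one at `-1` and the others inside the interval. -/
lemma exists_nodes (k : ℕ) :
    ∃ t : Finset ℝ, (∀ x ∈ t, x ∈ Set.Ioo (-1 : ℝ) 1) ∧ t.card = k ∧
      derivative^[k] (rodrigues k) =
        C (derivative^[k] (rodrigues k)).leadingCoeff *
          ((X + 1) * ∏ x ∈ t, (X - C x)) := by
  classical
  obtain ⟨t, ht, hcard⟩ := exists_roots_iterate_derivative_rodrigues k le_rfl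
  refine ⟨t, fun x hx => (ht x hx).1, hcard, ?_⟩
  have hnot : (-1 : ℝ) ∉ t := fun h => lt_irrefl _ (ht _ h).1.1
  have hdeg : (derivative^[k] (rodrigues k)).natDegree = k + 1 := by
    rw [natDegree_iterate_derivative_eq, natDegree_rodrigues]; lia
  have hroots := roots_eq_of_natDegree_le_card_of_ne_zero (S := insert (-1) t)
    (p := derivative^[k] (rodrigues k)) (fun x hx => by
      rcases Finset.mem_insert.1 hx with rfl | hx
      · exact eval_neg_one_iterate_derivative_rodrigues le_rfl
      · exact (ht x hx).2)
    (by rw [Finset.card_insert_of_notMem hnot, hdeg, hcard])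
    (iterate_derivative_rodrigues_ne_zero le_rfl)
  have h := C_leadingCoeff_mul_prod_multiset_X_sub_C (p := derivative^[k] (rodrigues k))
    (by rw [hroots, Finset.card_val, Finset.card_insert_of_notMem hnot, hdeg, hcard])
  rw [hroots] at h
  change _ * ∏ x ∈ insert (-1) t, (X - C x) = _ at h
  rw [Finset.prod_insert hnot] at h
  simpa using h.symm

lemma leadingCoeff_iterate_derivative_rodrigues (k : ℕ) :
    (derivative^[k] (rodrigues k)).leadingCoeff = (2 * k + 1).factorial / (k + 1).factorial := by
  have hdeg : (derivative^[k] (rodrigues k)).natDegree = k + 1 := by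
    rw [natDegree_iterate_derivative_eq, natDegree_rodrigues]; lia
  rw [leadingCoeff, hdeg, coeff_iterate_derivative, show k + 1 + k = 2 * k + 1 by ring,
    ← natDegree_rodrigues k, (rodrigues_monic k).coeff_natDegree, natDegree_rodrigues, nsmul_one,
    eq_div_iff (by positivity)]
  have := Nat.factorial_mul_descFactorial (show k ≤ 2 * k + 1 by lia)
  rw [show 2 * k + 1 - k = k + 1 by lia] at this
  rw [mul_comm]
  exact_mod_cast this

lemma iterate_derivative_of_monic_natDegree_eq {p : ℝ[X]} (hp : p.Monic) :
    derivative^[p.natDegree] p = C (p.natDegree.factorial : ℝ) := by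
  have hdeg := natDegree_iterate_derivative_eq p p.natDegree
  rw [Nat.sub_self] at hdeg
  rw [eq_C_of_natDegree_eq_zero hdeg, coeff_iterate_derivative, zero_add, hp.coeff_natDegree,
    Nat.descFactorial_self, nsmul_one]

/-- Integral of a polynomial against the node polynomial, by Rodrigues' formula. -/
lemma integralLM_mul_rodrigues (k : ℕ) (f : ℝ[X]) :
    integralLM (f * derivative^[k] (rodrigues k)) =
      (-1) ^ k * integralLM (derivative^[k] f * rodrigues k) :=
  integralLM_mul_iterate_derivative (fun _ => eval_one_iterate_derivative_rodrigues)
    (fun _ hj => eval_neg_one_iterate_derivative_rodrigues hj.le) f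

/-- Gauss-Radau quadrature: a polynomial of degree at most `2k` that is nonnegative at the nodes
has nonnegative integral. -/
lemma integralLM_nonneg_of_nonneg_nodes {k : ℕ} {t : Finset ℝ}
    (ht : ∀ x ∈ t, x ∈ Set.Ioo (-1 : ℝ) 1) (hcard : t.card = k)
    (horth : ∀ h : ℝ[X], h.degree < k →
      integralLM ((X + 1) * (∏ x ∈ t, (X - C x)) * h) = 0)
    {f : ℝ[X]} (hf : f.natDegree ≤ 2 * k) (hft : ∀ x ∈ t, 0 ≤ f.eval x)
    (hf1 : 0 ≤ f.eval (-1)) : 0 ≤ integralLM f := by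
  classical
  set A : ℝ[X] := ∏ x ∈ t, (X - C x) with hA
  have hAmonic : A.Monic := monic_prod_X_sub_C _ _
  have hAdeg : A.natDegree = k := by
    rw [hA, natDegree_finsetProd_X_sub_C_eq_card, hcard]
  have hXmonic : (X + 1 : ℝ[X]).Monic := monic_X_add_C (1 : ℝ)
  have hXdeg : (X + 1 : ℝ[X]).natDegree = 1 := natDegree_X_add_C (1 : ℝ)
  have hnot : (-1 : ℝ) ∉ t := fun h => lt_irrefl _ (ht _ h).1
  have hA0 : ∀ x ∈ t, A.eval x = 0 := fun x hx => by
    rw [hA, eval_prod]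
    exact Finset.prod_eq_zero hx (by simp)
  have hA1 : A.eval (-1) ≠ 0 := by
    rw [hA, eval_prod, Finset.prod_ne_zero_iff]
    intro x hx
    have := (ht x hx).1
    simp only [eval_sub, eval_X, eval_C]
    linarith
  have hinj : Set.InjOn (id : ℝ → ℝ) t := Function.injective_id.injOn
  set G : ℝ[X] := C (f.eval (-1) / A.eval (-1) ^ 2) * A ^ 2 +
    ∑ x ∈ t, C (f.eval x / (x + 1)) * ((X + 1) * Lagrange.basis t id x ^ 2) with hG
  have hGdeg : G.natDegree ≤ 2 * k := by
    refine natDegree_add_le_of_degree_le ((natDegree_C_mul_le _ _).trans ?_)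
      (natDegree_sum_le_of_forall_le _ _ fun x hx => (natDegree_C_mul_le _ _).trans ?_)
    · rw [hAmonic.natDegree_pow, hAdeg]
    · have hb : (Lagrange.basis t id x).natDegree = k - 1 := by
        rw [natDegree_eq_of_degree_eq_some (Lagrange.degree_basis hinj hx), hcard]
      have hk : 0 < k := hcard ▸ Finset.card_pos.2 ⟨x, hx⟩
      refine natDegree_mul_le.trans ?_
      rw [hXdeg, natDegree_pow, hb]
      lia
  have hGt : ∀ y ∈ t, G.eval y = f.eval y := fun y hy => by
    have hy1 : y + 1 ≠ 0 := by have := (ht y hy).1; linarith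
    rw [hG, eval_add, eval_mul, eval_pow, hA0 y hy, eval_finsetSum,
      Finset.sum_eq_single_of_mem y hy fun x _ hxy => ?_]
    · have := Lagrange.eval_basis_self hinj hy
      rw [id] at this
      simp [this, div_mul_cancel₀ _ hy1]
    · have := Lagrange.eval_basis_of_ne (v := (id : ℝ → ℝ)) hxy hy
      rw [id] at this
      simp [this]
  have hG1 : G.eval (-1) = f.eval (-1) := by
    rw [hG, eval_add, eval_finsetSum, Finset.sum_eq_zero fun x _ => by simp]
    simp [div_mul_cancel₀ _ (pow_ne_zero 2 hA1)]
  have hdvd : (X + 1) * A ∣ f - G := by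
    have h : ∏ x ∈ insert (-1) t, (X - C x) ∣ f - G := by
      refine Finset.prod_dvd_of_coprime
        ((pairwise_coprime_X_sub_C (Function.injective_id (α := ℝ))).set_pairwise _)
        fun x hx => ?_
      rw [dvd_iff_isRoot, IsRoot, eval_sub, sub_eq_zero]
      rcases Finset.mem_insert.1 hx with rfl | hx
      exacts [hG1.symm, (hGt x hx).symm]
    rw [Finset.prod_insert hnot] at h
    simpa using h
  obtain ⟨h, hh⟩ := hdvd
  have hhdeg : h.degree < k := by
    rcases eq_or_ne h 0 with rfl | h0
    · rw [degree_zero]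
      exact WithBot.bot_lt_coe k
    rw [degree_eq_natDegree h0, Nat.cast_lt]
    have h1 : (f - G).natDegree ≤ 2 * k := natDegree_sub_le_of_le hf hGdeg |>.trans (by simp)
    rw [hh, (hXmonic.mul hAmonic).natDegree_mul' h0, hXmonic.natDegree_mul hAmonic, hXdeg,
      hAdeg] at h1
    lia
  have hfG : integralLM f = integralLM G := by
    rw [← sub_eq_zero, ← map_sub, hh, horth h hhdeg]
  rw [hfG]
  refine integralLM_nonneg fun x hx => ?_
  have hx1 : 0 ≤ x + 1 := by linarith [hx.1]
  rw [hG, eval_add, eval_finsetSum]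
  refine add_nonneg ?_ (Finset.sum_nonneg fun y hy => ?_)
  · simp only [eval_mul, eval_C, eval_pow]
    positivity
  · have hy1 : 0 < y + 1 := by linarith [(ht y hy).1]
    have := hft y hy
    simp only [eval_mul, eval_C, eval_pow, eval_add, eval_X, eval_one]
    positivity

/-- The nonnegative monic polynomial of odd degree with least integral. -/
lemma exists_monic_nonneg_min_integralLM (k : ℕ) :
    ∃ r : ℝ[X], r.Monic ∧ r.natDegree = 2 * k + 1 ∧
      (∀ x ∈ Set.Icc (-1 : ℝ) 1, 0 ≤ r.eval x) ∧
      integralLM r = (k + 1).factorial / (2 * k + 1).factorial * k.factorial *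
        ((k + 1).factorial * k.factorial * 2 ^ (2 * k + 2) / (2 * k + 2).factorial) ∧
      ∀ q : ℝ[X], q.Monic → q.natDegree = 2 * k + 1 →
        (∀ x ∈ Set.Icc (-1 : ℝ) 1, 0 ≤ q.eval x) → integralLM r ≤ integralLM q := by
  obtain ⟨t, ht, hcard, hR⟩ := exists_nodes k
  set A : ℝ[X] := ∏ x ∈ t, (X - C x) with hA
  set c := (derivative^[k] (rodrigues k)).leadingCoeff with hc
  have hc0 : c ≠ 0 := leadingCoeff_ne_zero.2 (iterate_derivative_rodrigues_ne_zero le_rfl)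
  have hAmonic : A.Monic := monic_prod_X_sub_C _ _
  have hAdeg : A.natDegree = k := by
    rw [hA, natDegree_finsetProd_X_sub_C_eq_card, hcard]
  have hXmonic : (X + 1 : ℝ[X]).Monic := monic_X_add_C (1 : ℝ)
  have hXdeg : (X + 1 : ℝ[X]).natDegree = 1 := natDegree_X_add_C (1 : ℝ)
  have hint : ∀ f, c * integralLM ((X + 1) * A * f) =
      (-1) ^ k * integralLM (derivative^[k] f * rodrigues k) := fun f => by
    rw [← integralLM_mul_rodrigues, hR, ← smul_eq_mul, ← map_smul, smul_eq_C_mul]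
    congr 1
    ring
  have hrmonic : ((X + 1) * A * A).Monic := (hXmonic.mul hAmonic).mul hAmonic
  have hrdeg : ((X + 1) * A * A).natDegree = 2 * k + 1 := by
    rw [(hXmonic.mul hAmonic).natDegree_mul hAmonic, hXmonic.natDegree_mul hAmonic, hXdeg, hAdeg]
    ring
  refine ⟨(X + 1) * A * A, hrmonic, hrdeg, fun x hx => ?_, ?_, fun q hq hqdeg hqpos => ?_⟩
  · have hx1 : 0 ≤ x + 1 := by linarith [hx.1]
    simp only [eval_mul, eval_add, eval_X, eval_one, mul_assoc]
    exact mul_nonneg hx1 (mul_self_nonneg _)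
  · have hAk : derivative^[k] A = C (k.factorial : ℝ) := by
      have := iterate_derivative_of_monic_natDegree_eq hAmonic
      rwa [hAdeg] at this
    have h := hint A
    rw [hAk, ← smul_eq_C_mul, map_smul, rodrigues, integralLM_add_one_pow_mul_sub_one_pow,
      smul_eq_mul, hc, leadingCoeff_iterate_derivative_rodrigues,
      show k + 1 + k + 1 = 2 * k + 2 by ring] at h
    have hsq : ((-1 : ℝ) ^ k) * (-1) ^ k = 1 := by rw [← mul_pow]; simp
    have h2 : ((2 * k + 1).factorial / (k + 1).factorial : ℝ) ≠ 0 := by positivity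
    apply mul_left_cancel₀ h2
    rw [h]
    have h3 : ((2 * k + 1).factorial : ℝ) ≠ 0 := by positivity
    have h4 : ((k + 1).factorial : ℝ) ≠ 0 := by positivity
    calc _ = ((-1 : ℝ) ^ k * (-1) ^ k) * (k.factorial *
          ((k + 1).factorial * k.factorial * 2 ^ (2 * k + 2) / (2 * k + 2).factorial)) := by ring
      _ = _ := by rw [hsq]; field_simp
  · rw [← sub_nonneg, ← map_sub]
    have hroot : ∀ x, A.eval x = 0 → ((X + 1) * A * A).eval x = 0 := fun x hx => by
      rw [eval_mul, hx, mul_zero]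
    refine integralLM_nonneg_of_nonneg_nodes ht hcard (fun h hh => ?_) ?_ (fun x hx => ?_) ?_
    · have := hint h
      rw [iterate_derivative_eq_zero_of_degree_lt hh, zero_mul, map_zero, mul_zero] at this
      exact (mul_eq_zero.1 this).resolve_left hc0
    · have hlt : (q - (X + 1) * A * A).degree < q.degree := degree_sub_lt_left
        (by rw [degree_eq_natDegree hq.ne_zero, degree_eq_natDegree hrmonic.ne_zero, hqdeg,
          hrdeg]) hq.ne_zero (by rw [hq.leadingCoeff, hrmonic.leadingCoeff])
      rcases eq_or_ne (q - (X + 1) * A * A) 0 with h0 | h0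
      · simp [h0]
      · have := natDegree_lt_natDegree h0 hlt
        lia
    · have hAx : A.eval x = 0 := by
        rw [hA, eval_prod]
        exact Finset.prod_eq_zero hx (by simp)
      rw [eval_sub, hroot x hAx, sub_zero]
      exact hqpos x (Set.Ioo_subset_Icc_self (ht x hx))
    · have : 0 ≤ q.eval (-1) := hqpos (-1) (by norm_num)
      simpa using this

lemma exists_derivative_eq (q : ℝ[X]) : ∃ P : ℝ[X], derivative P = q := by
  refine ⟨∑ i ∈ Finset.range (q.natDegree + 1), C (q.coeff i / (i + 1)) * X ^ (i + 1), ?_⟩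
  conv_rhs => rw [q.as_sum_range_C_mul_X_pow]
  rw [derivative_sum]
  refine Finset.sum_congr rfl fun i _ => ?_
  rw [derivative_C_mul_X_pow, Nat.add_sub_cancel]
  congr 2
  push_cast
  exact div_mul_cancel₀ _ (by positivity)

end

lemma prod_odd_mul_two_pow_mul_factorial (m : ℕ) :
    (∏ i ∈ Finset.range m, (2 * (i : ℝ) + 1)) * (2 ^ m * m.factorial) = (2 * m).factorial := by
  induction m with
  | zero => simp
  | succ m ih =>
    rw [Finset.prod_range_succ, show 2 * (m + 1) = 2 * m + 1 + 1 by ring]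
    simp only [Nat.factorial_succ, Nat.cast_mul, ← ih]
    push_cast
    ring

lemma abs_le_supNorm {f : ℝ → ℝ} (hf : Continuous f) {x : ℝ} (hx : x ∈ Set.Icc (-1 : ℝ) 1) :
    |f x| ≤ supNorm f :=
  le_csSup (isCompact_Icc.image hf.abs).bddAbove (Set.mem_image_of_mem _ hx)

/-- Chebyshev: among monic polynomials of degree `2m` that are nondecreasing on
`[-1,1]` (i.e. `P' ≥ 0` there), the least possible sup norm is
`2 (m!/(2m−1)!!)²`. -/
theorem stmt14 (m : ℕ) (hm : 1 ≤ m) :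
    sInf { e | ∃ P : Polynomial ℝ, P.Monic ∧ P.natDegree = 2 * m ∧
        (∀ x ∈ Icc (-1:ℝ) 1, 0 ≤ (Polynomial.derivative P).eval x) ∧
        e = supNorm (fun x => P.eval x) } =
      2 * ((m.factorial : ℝ) / ∏ i ∈ Finset.range m, (2 * (i:ℝ) + 1)) ^ 2 := by
  obtain ⟨k, rfl⟩ : ∃ k, m = k + 1 := ⟨m - 1, by lia⟩
  obtain ⟨r, hr, hrdeg, hrpos, hrint, hrmin⟩ := exists_monic_nonneg_min_integralLM k
  have hk : (0 : ℝ) < k + 1 := by positivity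
  have hval : ((k : ℝ) + 1) * integralLM r =
      2 * (((k + 1).factorial : ℝ) / ∏ i ∈ Finset.range (k + 1), (2 * (i : ℝ) + 1)) ^ 2 := by
    have hprod := prod_odd_mul_two_pow_mul_factorial (k + 1)
    have hf : (0 : ℝ) < (k + 1).factorial := by positivity
    have h2 : (2 * (k + 1)).factorial = (2 * k + 2) * (2 * k + 1).factorial :=
      Nat.factorial_succ (2 * k + 1)
    have h3 : ((k + 1).factorial : ℝ) = (k + 1) * k.factorial := by
      rw [Nat.factorial_succ]; push_cast; ring
    have h4 : ∏ i ∈ Finset.range (k + 1), (2 * (i : ℝ) + 1) =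
        ((2 * k + 2) * (2 * k + 1).factorial : ℝ) / (2 ^ (k + 1) * (k + 1).factorial) := by
      rw [eq_div_iff (by positivity), hprod, h2]
      push_cast
      ring
    rw [h4, hrint, show (2 * k + 2).factorial = (2 * k + 2) * (2 * k + 1).factorial from h2, h3]
    push_cast
    have h5 : ((2 * k + 1).factorial : ℝ) ≠ 0 := by positivity
    have h6 : (k.factorial : ℝ) ≠ 0 := by positivity
    field_simp
    ring
  rw [← hval]
  refine IsLeast.csInf_eq ⟨?_, ?_⟩
  · obtain ⟨P, hP⟩ := exists_derivative_eq (Polynomial.C (2 * ((k : ℝ) + 1)) * r)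
    have hdegP : P.natDegree = 2 * (k + 1) := by
      have := congrArg Polynomial.natDegree hP
      rw [Polynomial.natDegree_derivative, Polynomial.natDegree_C_mul (by positivity), hrdeg]
        at this
      lia
    have hlead : P.leadingCoeff = 1 := by
      have := congrArg Polynomial.leadingCoeff hP
      rw [Polynomial.leadingCoeff_derivative, Polynomial.leadingCoeff_mul,
        Polynomial.leadingCoeff_C, hr.leadingCoeff, hdegP] at this
      push_cast at this
      exact mul_right_cancel₀ (b := 2 * ((k : ℝ) + 1)) (by positivity) (by linarith)
    have hint := integralLM_derivative P
    rw [hP, ← Polynomial.smul_eq_C_mul, map_smul, smul_eq_mul] at hint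
    set d := (P.eval 1 + P.eval (-1)) / 2 with hd
    have hdeg : (P - Polynomial.C d).natDegree = 2 * (k + 1) := by
      rw [Polynomial.natDegree_sub_C, hdegP]
    have hder : Polynomial.derivative (P - Polynomial.C d) =
        Polynomial.C (2 * ((k : ℝ) + 1)) * r := by simp [hP]
    have hpos : ∀ x ∈ Set.Icc (-1 : ℝ) 1,
        0 ≤ (Polynomial.derivative (P - Polynomial.C d)).eval x := fun x hx => by
      have := hrpos x hx
      rw [hder, Polynomial.eval_mul, Polynomial.eval_C]
      positivity
    have hmono : MonotoneOn (fun x => (P - Polynomial.C d).eval x) (Set.Icc (-1 : ℝ) 1) :=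
      monotoneOn_of_deriv_nonneg (convex_Icc _ _) (Polynomial.continuousOn _)
        (Polynomial.differentiableOn _) fun x hx => by
          rw [Polynomial.deriv]
          exact hpos x (interior_subset hx)
    refine ⟨P - Polynomial.C d, ?_, hdeg, hpos, le_antisymm ?_ ?_⟩
    · rw [Polynomial.Monic, Polynomial.leadingCoeff, hdeg, Polynomial.coeff_sub,
        Polynomial.coeff_C_of_ne_zero (by lia), sub_zero, ← hdegP]
      exact hlead
    · have := abs_le_supNorm (f := fun x => (P - Polynomial.C d).eval x)
        (Polynomial.continuous _) (x := 1) (by norm_num)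
      refine le_trans ?_ ((le_abs_self _).trans this)
      simp only [Polynomial.eval_sub, Polynomial.eval_C]
      linarith
    · refine csSup_le ⟨_, Set.mem_image_of_mem _ (show (0 : ℝ) ∈ Set.Icc (-1) 1 by norm_num)⟩ ?_
      rintro _ ⟨x, hx, rfl⟩
      have h1 := hmono hx (show (1 : ℝ) ∈ Set.Icc (-1) 1 by norm_num) hx.2
      have h2 := hmono (show (-1 : ℝ) ∈ Set.Icc (-1) 1 by norm_num) hx hx.1
      simp only [Polynomial.eval_sub, Polynomial.eval_C] at h1 h2 ⊢
      rw [abs_le]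
      constructor <;> linarith
  · rintro _ ⟨P, hP, hdeg, hpos, rfl⟩
    have h2k : (0 : ℝ) < 2 * (k + 1) := by positivity
    have hlead : (Polynomial.derivative P).leadingCoeff = 2 * ((k : ℝ) + 1) := by
      rw [Polynomial.leadingCoeff_derivative, hP.leadingCoeff, hdeg]
      push_cast
      ring
    have hmin := hrmin (Polynomial.C (2 * ((k : ℝ) + 1))⁻¹ * Polynomial.derivative P)
      (by rw [Polynomial.Monic, Polynomial.leadingCoeff_mul, Polynomial.leadingCoeff_C, hlead,
        inv_mul_cancel₀ h2k.ne'])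
      (by rw [Polynomial.natDegree_C_mul (inv_ne_zero h2k.ne'), Polynomial.natDegree_derivative,
        hdeg]; lia)
      (fun x hx => by
        rw [Polynomial.eval_mul, Polynomial.eval_C]
        exact mul_nonneg (inv_nonneg.2 h2k.le) (hpos x hx))
    rw [← Polynomial.smul_eq_C_mul, map_smul, smul_eq_mul, integralLM_derivative,
      inv_mul_eq_div, le_div_iff₀ h2k] at hmin
    have h1 := (le_abs_self _).trans (abs_le_supNorm (f := fun x => P.eval x) P.continuous
      (x := 1) (by norm_num))
    have h2 := (neg_le_abs _).trans (abs_le_supNorm (f := fun x => P.eval x) P.continuous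
      (x := -1) (by norm_num))
    linarith
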